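/- Assume the HardMax response function with fair tie-breaking, i.e. f_resp(x) = 1 for x > 0, f_resp(x) = 0 for x < 0, and f_resp(0) = 1/2. If principal 1's algorithm ALG_1 is BayesGreedy and principal 2's algorithm ALG_2 deviates from BayesGreedy starting from some local step n_0 < T, then every agent in global rounds t ≥ n_0 selects principal 1 (with probability 1). -/

import Mathlib

/-
A formalization of the Bayesian-choice model of competing bandits.

Two principals each commit to a multi-armed bandit algorithm over a finite set
`A` of arms with Bernoulli rewards.  The mean-reward vector `w : A → ℝ` is drawn
once from a common Bayesian prior `P`.  An algorithm is a map from (reversed)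
histories of (arm, reward) pairs to distributions over arms.  Agents arrive
sequentially; agent `t` (rounds are 1-indexed) chooses principal 1 with
probability `fresp (PMR₁(t) - PMR₂(t))`, where `PMRᵢ(t)` is the Bayesian
posterior mean reward of principal `i`'s next local step; the chosen principal's
algorithm advances one local step.
-/

open MeasureTheory
open scoped Classical

namespace BayesianChoice

/-- A history: a list of (arm, Bernoulli reward) pairs, most recent step first. -/
abbrev History (A : Type) := List (A × Bool)

/-- An MAB algorithm: a distribution over arms, given the observed history.
(Note that such algorithms never depend on the time horizon `T`:
they are automatically `T`-oblivious.) -/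
abbrev Alg (A : Type) := History A → PMF A

variable {A : Type} [Fintype A] [Nonempty A]

/-- Likelihood of the reward sequence in history `h`, given mean-reward vector `w`
(rewards are Bernoulli, independent across steps given `w`). -/
noncomputable def lik (w : A → ℝ) : History A → ℝ
  | [] => 1
  | (a, r) :: h => lik w h * (if r then w a else 1 - w a)

/-- Probability that a stand-alone run of `alg` produces history `h`, given `w`. -/
noncomputable def hProb (alg : Alg A) (w : A → ℝ) : History A → ℝ
  | [] => 1
  | (a, r) :: h => hProb alg w h * ((alg h) a).toReal * (if r then w a else 1 - w a)

variable (P : Measure (A → ℝ))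

/-- The prior `P` is supported on mean rewards in `[0,1]` (Bernoulli parameters). -/
def PriorOnUnitCube : Prop := P {w | ∀ a : A, w a ∈ Set.Icc (0:ℝ) 1} = 1

/-- A history is feasible if it has positive marginal likelihood under the prior. -/
def Feasible (h : History A) : Prop := 0 < ∫ w, lik w h ∂P

/-- Posterior mean reward `E[μ_a | h]` of arm `a` given history `h`. -/
noncomputable def postMean (h : History A) (a : A) : ℝ :=
  (∫ w, w a * lik w h ∂P) / ∫ w, lik w h ∂P

/-- Prior assumption (i): each arm can be the (strictly) best arm. -/
def EachArmCanBeBest : Prop := ∀ a : A, 0 < P {w | ∀ a' : A, a' ≠ a → w a' < w a}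

/-- Prior assumption (ii): posterior mean rewards are pairwise distinct
given any feasible history. -/
def DistinctPosteriorMeans : Prop :=
  ∀ h : History A, Feasible P h → ∀ a a' : A, a ≠ a' → postMean P h a ≠ postMean P h a'

/-- `alg` is (a version of) `BayesGreedy`: on every feasible history it only plays arms
with the largest posterior mean reward. -/
def IsBayesGreedy (alg : Alg A) : Prop :=
  ∀ h : History A, Feasible P h →
    ∀ a ∈ (alg h).support, ∀ a' : A, postMean P h a' ≤ postMean P h a

/-- `alg` is (a version of) `StaticGreedy`: it always plays an arm with the largest
prior mean reward. -/
def IsStaticGreedy (alg : Alg A) : Prop :=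
  ∀ h : History A, ∀ a ∈ (alg h).support,
    ∀ a' : A, postMean P ([] : History A) a' ≤ postMean P ([] : History A) a

/-- Marginal probability that a stand-alone run of `alg` produces history `h`. -/
noncomputable def prH (alg : Alg A) (h : History A) : ℝ := ∫ w, hProb alg w h ∂P

/-- `alg` and `alg'` deviate at (local, 1-indexed) step `n`: there is a set `H` of
histories over the previous `n-1` steps, reached with positive probability by both
algorithms, on which they choose different distributions over arms. -/
def DeviatesAt (alg alg' : Alg A) (n : ℕ) : Prop :=
  ∃ H : Set (History A),
    (∀ h ∈ H, h.length + 1 = n) ∧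
    (∃ h ∈ H, 0 < prH P alg h) ∧ (∃ h ∈ H, 0 < prH P alg' h) ∧
    (∀ h ∈ H, alg h ≠ alg' h)

/-- `alg` deviates from `alg'` starting from step `n₀`:
`n₀` is the smallest step at which they deviate. -/
def DeviatesFrom (alg alg' : Alg A) (n₀ : ℕ) : Prop :=
  DeviatesAt P alg alg' n₀ ∧ ∀ n < n₀, ¬ DeviatesAt P alg alg' n

/-- `E[rew(n)]`: the Bayesian-expected reward collected at local step `n` (1-indexed)
by a stand-alone run of `alg`. -/
noncomputable def rewE (alg : Alg A) (n : ℕ) : ℝ :=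
  ∑' h : {h : History A // h.length + 1 = n},
    ∫ w, hProb alg w h.1 * ∑ a : A, ((alg h.1) a).toReal * w a ∂P

/-- `E[max_a μ_a]`: Bayesian-expected reward of the best arm. -/
noncomputable def optE : ℝ := ∫ w, ⨆ a : A, w a ∂P

/-- Bayesian instantaneous regret of `alg` at local step `n` (stand-alone run). -/
noncomputable def BIR (alg : Alg A) (n : ℕ) : ℝ := optE P - rewE P alg n

/-- `alg` is Bayesian-monotone: its Bayesian-expected reward is non-decreasing in `n`. -/
def BayesianMonotone (alg : Alg A) : Prop :=
  ∀ n m : ℕ, 1 ≤ n → n ≤ m → rewE P alg n ≤ rewE P alg m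

/- ### The competition game -/

/-- Bayesian-expected reward of the next local step of `alg`, when the joint
distribution over (mean vector, pair of local histories) has density `g` against `P`,
and `sel` extracts `alg`'s local history from the pair. -/
noncomputable def nextStepReward (alg : Alg A) (sel : History A × History A → History A)
    (g : (A → ℝ) → History A × History A → ℝ) : ℝ :=
  ∑' s : History A × History A, ∫ w, g w s * ∑ a : A, ((alg (sel s)) a).toReal * w a ∂P

/-- One global round of the game: the current agent chooses principal 1 with
probability `q`; the chosen principal's algorithm advances one local step. -/
noncomputable def stepDist (alg1 alg2 : Alg A) (q : ℝ)
    (g : (A → ℝ) → History A × History A → ℝ) :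
    (A → ℝ) → History A × History A → ℝ := fun w s =>
  (match s.1 with
   | [] => 0
   | (a, r) :: h1' =>
       q * g w (h1', s.2) * ((alg1 h1') a).toReal * (if r then w a else 1 - w a)) +
  (match s.2 with
   | [] => 0
   | (a, r) :: h2' =>
       (1 - q) * g w (s.1, h2') * ((alg2 h2') a).toReal * (if r then w a else 1 - w a))

/-- Joint distribution (density against the prior) over the pair of local histories
after `t` global rounds of the competition game, when the principals play
`(alg1, alg2)` and agents respond via `fresp`. -/
noncomputable def gameDist (alg1 alg2 : Alg A) (fresp : ℝ → ℝ) :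
    ℕ → (A → ℝ) → History A × History A → ℝ
  | 0 => fun _ s => if s = (([] : History A), ([] : History A)) then 1 else 0
  | t + 1 =>
      stepDist alg1 alg2
        (fresp (nextStepReward P alg1 Prod.fst (gameDist alg1 alg2 fresp t) -
                nextStepReward P alg2 Prod.snd (gameDist alg1 alg2 fresp t)))
        (gameDist alg1 alg2 fresp t)

/-- `PMR₁(t) = E[r_t | i_t = 1] = E[rew_1(n_1(t)+1)]`: posterior mean reward of
principal 1 at global round `t` (rounds are 1-indexed). -/
noncomputable def PMR1 (alg1 alg2 : Alg A) (fresp : ℝ → ℝ) (t : ℕ) : ℝ :=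
  nextStepReward P alg1 Prod.fst (gameDist P alg1 alg2 fresp (t - 1))

/-- `PMR₂(t)`: posterior mean reward of principal 2 at global round `t`. -/
noncomputable def PMR2 (alg1 alg2 : Alg A) (fresp : ℝ → ℝ) (t : ℕ) : ℝ :=
  nextStepReward P alg2 Prod.snd (gameDist P alg1 alg2 fresp (t - 1))

/-- Probability that agent `t` chooses principal 1:
`Pr[i_t = 1] = fresp (PMR₁(t) - PMR₂(t))`. -/
noncomputable def probChoose1 (alg1 alg2 : Alg A) (fresp : ℝ → ℝ) (t : ℕ) : ℝ :=
  fresp (PMR1 P alg1 alg2 fresp t - PMR2 P alg1 alg2 fresp t)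

/-- Expected number of the `T` agents that choose principal 1 (principal 1's utility). -/
noncomputable def marketShare1 (alg1 alg2 : Alg A) (fresp : ℝ → ℝ) (T : ℕ) : ℝ :=
  ∑ t ∈ Finset.Icc 1 T, probChoose1 P alg1 alg2 fresp t

/-- Expected number of the `T` agents that choose principal 2 (principal 2's utility). -/
noncomputable def marketShare2 (alg1 alg2 : Alg A) (fresp : ℝ → ℝ) (T : ℕ) : ℝ :=
  ∑ t ∈ Finset.Icc 1 T, (1 - probChoose1 P alg1 alg2 fresp t)

/-- `(a1, a2)` is a (pure) Nash equilibrium of the competition game with horizon `T`,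
response function `fresp`, and feasible strategy set `F`; each principal's utility
is the expected number of agents who choose her. -/
def IsNash (F : Set (Alg A)) (fresp : ℝ → ℝ) (T : ℕ) (a1 a2 : Alg A) : Prop :=
  a1 ∈ F ∧ a2 ∈ F ∧
  (∀ a1' ∈ F, marketShare1 P a1' a2 fresp T ≤ marketShare1 P a1 a2 fresp T) ∧
  (∀ a2' ∈ F, marketShare2 P a1 a2' fresp T ≤ marketShare2 P a1 a2 fresp T)

/- ### Response functions -/

/-- `HardMax` response function (its value at `0` — the tie-breaking rule —
is specified separately). -/
def IsHardMax (f : ℝ → ℝ) : Prop :=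
  (∀ x : ℝ, 0 < x → f x = 1) ∧ (∀ x : ℝ, x < 0 → f x = 0)

/-- `HardMax&Random` response function with baseline probability `ε₀ = f(-1)`. -/
def IsHardMaxRandom (f : ℝ → ℝ) (ε₀ : ℝ) : Prop :=
  ε₀ ∈ Set.Ioo (0:ℝ) (1/2 : ℝ) ∧ f (-1) = ε₀ ∧
  (∀ x : ℝ, 0 < x → f x = 1 - ε₀) ∧ (∀ x : ℝ, x < 0 → f x = ε₀)

/-- A symmetric response function: `f(x) + f(-x) = 1` for all `x ∈ [0,1]`. -/
def SymmetricResp (f : ℝ → ℝ) : Prop := ∀ x ∈ Set.Icc (0:ℝ) 1, f x + f (-x) = 1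

/-- `SoftMax` response function with smoothness constants `δ₀, c₀, c₀'`. -/
def IsSoftMax (f : ℝ → ℝ) (δ₀ c₀ c₀' : ℝ) : Prop :=
  (∃ ε ∈ Set.Ioo (0:ℝ) (1/2 : ℝ), ∀ x : ℝ, f x ∈ Set.Icc ε (1 - ε)) ∧
  f 0 = 1/2 ∧ 0 < δ₀ ∧ 0 < c₀ ∧ 0 < c₀' ∧
  ∀ x ∈ Set.Icc (-δ₀) δ₀, DifferentiableAt ℝ f x ∧ c₀ ≤ deriv f x ∧ deriv f x ≤ c₀'

/-- `alg1` BIR-dominates `alg2` starting from step `n₀`: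
`BIR₁(ε₀ n / 2) / BIR₂(n) < 1/2` for all `n ≥ n₀`. -/
def BIRDominates (alg1 alg2 : Alg A) (ε₀ : ℝ) (n₀ : ℕ) : Prop :=
  ∀ n : ℕ, n₀ ≤ n → BIR P alg1 ⌊ε₀ * n / 2⌋₊ / BIR P alg2 n < 1/2

/-- `alg1` weakly BIR-dominates `alg2` with constants `β₀, α₀ ∈ (0,1/2)`, from step `n₀`:
`BIR₁((1-β₀) n) / BIR₂(n) < 1 - α₀` for all `n ≥ n₀`. -/
def WeakBIRDominates (alg1 alg2 : Alg A) (β₀ α₀ : ℝ) (n₀ : ℕ) : Prop :=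
  ∀ n : ℕ, n₀ ≤ n → BIR P alg1 ⌊(1 - β₀) * n⌋₊ / BIR P alg2 n < 1 - α₀

end BayesianChoice

namespace BayesianChoice

open MeasureTheory

/- ### Helper material -/

/-- Finset of histories of length `n`. -/
noncomputable def hs (A : Type) [Fintype A] : ℕ → Finset (History A)
  | 0 => {[]}
  | n + 1 => (hs A n ×ˢ (Finset.univ : Finset (A × Bool))).image (fun x => x.2 :: x.1)

section helpers

variable {A : Type} [Fintype A]

lemma mem_hs (n : ℕ) (h : History A) : h ∈ hs A n ↔ h.length = n := by
  induction n generalizing h with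
  | zero => simp [hs]
  | succ n ih =>
    cases h with
    | nil => simp [hs]
    | cons x h =>
      rw [hs, Finset.mem_image]
      constructor
      · rintro ⟨⟨a, b⟩, hb, he⟩
        have h2 := (ih _).1 (Finset.mem_product.1 hb).1
        rw [← he, List.length_cons, h2]
      · intro hh
        rw [List.length_cons] at hh
        exact ⟨(h, x), Finset.mem_product.2 ⟨(ih h).2 (Nat.succ.inj hh), Finset.mem_univ _⟩, rfl⟩

lemma sum_hs_succ (n : ℕ) (f : History A → ℝ) :
    ∑ h ∈ hs A (n+1), f h = ∑ h ∈ hs A n, ∑ a : A, (f ((a, true) :: h) + f ((a, false) :: h)) := by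
  rw [hs, Finset.sum_image, Finset.sum_product]
  · apply Finset.sum_congr rfl
    intro h _
    rw [Fintype.sum_prod_type]
    simp
  · rintro ⟨a, b⟩ _ ⟨c, d⟩ _ h
    simp only [List.cons.injEq] at h
    ext1
    · exact h.2
    · exact h.1

lemma pmf_sum (p : PMF A) : ∑ a, (p a).toReal = 1 := by
  have h := p.tsum_coe
  rw [tsum_fintype] at h
  rw [← ENNReal.toReal_sum (fun a _ => p.apply_ne_top a), h]
  simp

lemma sum_hProb (alg : Alg A) (w : A → ℝ) (n : ℕ) : ∑ h ∈ hs A n, hProb alg w h = 1 := by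
  induction n with
  | zero => simp [hs, hProb]
  | succ n ih =>
    rw [sum_hs_succ, ← ih]
    apply Finset.sum_congr rfl
    intro h _
    have : ∀ a : A, hProb alg w ((a, true) :: h) + hProb alg w ((a, false) :: h)
        = hProb alg w h * ((alg h) a).toReal := by
      intro a; simp [hProb]; ring
    rw [Finset.sum_congr rfl (fun a _ => this a), ← Finset.mul_sum, pmf_sum, mul_one]

/-- Probability weight of the algorithm's choices. -/
noncomputable def cw (alg : Alg A) : History A → ℝ
  | [] => 1
  | (a, _) :: h => cw alg h * ((alg h) a).toReal

lemma cw_nonneg (alg : Alg A) (h : History A) : 0 ≤ cw alg h := by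
  induction h with
  | nil => simp [cw]
  | cons x h ih => exact mul_nonneg ih ENNReal.toReal_nonneg

lemma hProb_eq (alg : Alg A) (w : A → ℝ) (h : History A) : hProb alg w h = cw alg h * lik w h := by
  induction h with
  | nil => simp [cw, hProb, lik]
  | cons x h ih =>
    obtain ⟨a, r⟩ := x
    simp only [hProb, cw, lik, ih]; ring

lemma lik_meas (h : History A) : Measurable (fun w : A → ℝ => lik w h) := by
  induction h with
  | nil => simp [lik]
  | cons x h ih =>
    obtain ⟨a, r⟩ := x
    cases r <;> simp only [lik] <;> simp <;> fun_prop

lemma lik_bdd (h : History A) (w : A → ℝ) (hw : ∀ a, w a ∈ Set.Icc (0:ℝ) 1) :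
    0 ≤ lik w h ∧ lik w h ≤ 1 := by
  induction h with
  | nil => simp [lik]
  | cons x h ih =>
    obtain ⟨a, r⟩ := x
    have := hw a
    have h3 : 0 ≤ (if r then w a else 1 - w a) ∧ (if r then w a else 1 - w a) ≤ 1 := by
      split_ifs
      · exact ⟨this.1, this.2⟩
      · constructor <;> linarith [this.1, this.2]
    simp only [lik]
    exact ⟨mul_nonneg ih.1 h3.1, mul_le_one₀ ih.2 h3.1 h3.2⟩

variable (P : Measure (A → ℝ)) [IsProbabilityMeasure P]

lemma ae_cube (hcube : PriorOnUnitCube P) : ∀ᵐ w ∂P, ∀ a, w a ∈ Set.Icc (0:ℝ) 1 := by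
  have hm : MeasurableSet {w : A → ℝ | ∀ a : A, w a ∈ Set.Icc (0:ℝ) 1} := by
    rw [Set.ofPred_forall]
    exact MeasurableSet.iInter fun a => measurableSet_Icc.preimage (measurable_pi_apply a)
  exact (prob_compl_eq_zero_iff hm).2 hcube

lemma integrable_of (hcube : PriorOnUnitCube P) (f : (A → ℝ) → ℝ) (hf : Measurable f) (C : ℝ)
    (hC : ∀ w : A → ℝ, (∀ a, w a ∈ Set.Icc (0:ℝ) 1) → |f w| ≤ C) : Integrable f P := by
  refine Integrable.of_bound hf.aestronglyMeasurable C ?_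
  filter_upwards [ae_cube P hcube] with w hw
  exact hC w hw

lemma lik_int (hcube : PriorOnUnitCube P) (h : History A) : Integrable (fun w => lik w h) P := by
  refine integrable_of P hcube _ (lik_meas h) 1 fun w hw => ?_
  have := lik_bdd h w hw
  rw [abs_of_nonneg this.1]; exact this.2

/-- Marginal likelihood. -/
noncomputable def LL (h : History A) : ℝ := ∫ w, lik w h ∂P

lemma LL_nonneg (hcube : PriorOnUnitCube P) (h : History A) : 0 ≤ LL P h := by
  apply integral_nonneg_of_ae
  filter_upwards [ae_cube P hcube] with w hw
  exact (lik_bdd h w hw).1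

lemma LL_split (hcube : PriorOnUnitCube P) (h : History A) (a : A) :
    LL P ((a, true) :: h) + LL P ((a, false) :: h) = LL P h := by
  unfold LL
  rw [← integral_add (lik_int P hcube _) (lik_int P hcube _)]
  congr 1; ext w
  simp [lik]; ring

/-- Unnormalised posterior mean after playing arms `b` first. -/
lemma LL_comm (h : History A) (x y : A × Bool) : LL P (x :: y :: h) = LL P (y :: x :: h) := by
  unfold LL
  congr 1; ext w
  obtain ⟨a, r⟩ := x
  obtain ⟨b, s⟩ := y
  simp only [lik]; ring

lemma LL_tail (hcube : PriorOnUnitCube P) (h : History A) (a : A) (r : Bool) :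
    LL P ((a, r) :: h) ≤ LL P h := by
  have := LL_split P hcube h a
  have h1 := LL_nonneg P hcube ((a, true) :: h)
  have h2 := LL_nonneg P hcube ((a, false) :: h)
  cases r <;> linarith

lemma postMean_eq (h : History A) (a : A) :
    postMean P h a = LL P ((a, true) :: h) / LL P h := by
  unfold postMean LL
  congr 2; ext w; simp [lik]; ring

lemma prH_eq (alg : Alg A) (h : History A) : prH P alg h = cw alg h * LL P h := by
  unfold prH LL
  rw [← integral_const_mul]
  congr 1; ext w; exact hProb_eq _ _ _

/-- Expected reward (unnormalised) at history `h`. -/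
noncomputable def GG (alg : Alg A) (h : History A) : ℝ :=
  ∑ a : A, ((alg h) a).toReal * LL P ((a, true) :: h)

/-- Expected reward at the local step following `n` steps. -/
noncomputable def SS (alg : Alg A) (n : ℕ) : ℝ := ∑ h ∈ hs A n, cw alg h * GG P alg h

lemma pmf_avg_ge (p : PMF A) (M : A → ℝ) (x : ℝ) (hx : ∀ a ∈ p.support, x ≤ M a) :
    x ≤ ∑ a, (p a).toReal * M a := by
  calc x = ∑ a, (p a).toReal * x := by rw [← Finset.sum_mul, pmf_sum, one_mul]
    _ ≤ _ := by
      apply Finset.sum_le_sum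
      intro a _
      by_cases ha : p a = 0
      · simp [ha]
      · exact mul_le_mul_of_nonneg_left (hx a ((p.mem_support_iff a).2 ha)) ENNReal.toReal_nonneg

lemma pmf_avg_le (p : PMF A) (M : A → ℝ) (x : ℝ) (hx : ∀ a, M a ≤ x) :
    ∑ a, (p a).toReal * M a ≤ x := by
  calc ∑ a, (p a).toReal * M a ≤ ∑ a, (p a).toReal * x :=
      Finset.sum_le_sum fun a _ => mul_le_mul_of_nonneg_left (hx a) ENNReal.toReal_nonneg
    _ = x := by rw [← Finset.sum_mul, pmf_sum, one_mul]

lemma pmf_pure (p : PMF A) (M : A → ℝ) (b : A) (hM : ∀ a, a ≠ b → M a < M b)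
    (hp : M b ≤ ∑ a, (p a).toReal * M a) : p = PMF.pure b := by
  have h0 : ∀ a, a ≠ b → p a = 0 := by
    intro a hab
    by_contra hne
    have hpos : 0 < (p a).toReal := ENNReal.toReal_pos hne (p.apply_ne_top a)
    have : ∑ a, (p a).toReal * M a < ∑ a, (p a).toReal * M b := by
      apply Finset.sum_lt_sum
      · intro c _
        apply mul_le_mul_of_nonneg_left _ ENNReal.toReal_nonneg
        by_cases hc : c = b
        · rw [hc]
        · exact (hM c hc).le
      · exact ⟨a, Finset.mem_univ _, mul_lt_mul_of_pos_left (hM a hab) hpos⟩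
    rw [← Finset.sum_mul, pmf_sum, one_mul] at this
    linarith
  ext a
  by_cases hab : a = b
  · subst hab
    have := p.tsum_coe
    rw [tsum_eq_single a (fun c hc => h0 c hc)] at this
    simp [this]
  · rw [h0 a hab, PMF.pure_apply, if_neg hab]

lemma greedy_ge (hcube : PriorOnUnitCube P) (alg : Alg A) (hBG : IsBayesGreedy P alg)
    (h : History A) (b : A) : LL P ((b, true) :: h) ≤ GG P alg h := by
  apply pmf_avg_ge
  intro a ha
  rcases (LL_nonneg P hcube h).eq_or_lt with h0 | hpos
  · have := LL_tail P hcube h b true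
    have := LL_nonneg P hcube ((a, true) :: h)
    linarith
  · have := hBG h hpos a ha b
    rw [postMean_eq, postMean_eq] at this
    exact (div_le_div_iff_of_pos_right hpos).1 this

lemma GG_le (hcube : PriorOnUnitCube P) (alg alg' : Alg A) (hBG : IsBayesGreedy P alg)
    (h : History A) : GG P alg' h ≤ GG P alg h :=
  pmf_avg_le _ _ _ fun a => greedy_ge P hcube alg hBG h a

lemma GG_lt (hcube : PriorOnUnitCube P) (hdist : DistinctPosteriorMeans P)
    (alg alg' : Alg A) (hBG : IsBayesGreedy P alg)
    (h : History A) (hf : 0 < LL P h) (hne : alg' h ≠ alg h) : GG P alg' h < GG P alg h := by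
  refine lt_of_le_of_ne (GG_le P hcube alg alg' hBG h) fun heq => hne ?_
  obtain ⟨b, hb⟩ := (alg h).support_nonempty
  have hM : ∀ a, a ≠ b → LL P ((a, true) :: h) < LL P ((b, true) :: h) := by
    intro a hab
    have h1 := hBG h hf b hb a
    have h2 := hdist h hf a b hab
    have h3 := lt_of_le_of_ne h1 h2
    rw [postMean_eq, postMean_eq] at h3
    exact (div_lt_div_iff_of_pos_right hf).1 h3
  have h1 := greedy_ge P hcube alg hBG h b
  rw [pmf_pure (alg h) (fun a => LL P ((a, true) :: h)) b hM h1,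
    pmf_pure (alg' h) (fun a => LL P ((a, true) :: h)) b hM (h1.trans heq.ge)]

lemma SS_mono (hcube : PriorOnUnitCube P) (alg : Alg A) (hBG : IsBayesGreedy P alg) (n : ℕ) :
    SS P alg n ≤ SS P alg (n+1) := by
  unfold SS
  rw [sum_hs_succ]
  apply Finset.sum_le_sum
  intro h _
  unfold GG
  rw [Finset.mul_sum]
  apply Finset.sum_le_sum
  intro a _
  have h1 := greedy_ge P hcube alg hBG ((a, true) :: h) a
  have h2 := greedy_ge P hcube alg hBG ((a, false) :: h) a
  have h3 := LL_split P hcube ((a, true) :: h) a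
  rw [LL_comm P h (a, false) (a, true)] at h3
  have hc : 0 ≤ cw alg h * ((alg h) a).toReal := mul_nonneg (cw_nonneg _ _) ENNReal.toReal_nonneg
  have h4 := mul_le_mul_of_nonneg_left (add_le_add h1 h2) hc
  rw [h3] at h4
  unfold GG at h4
  simp only [cw]
  linarith

lemma GG_zero (hcube : PriorOnUnitCube P) (alg : Alg A) (h : History A) (h0 : LL P h = 0) :
    GG P alg h = 0 := by
  unfold GG
  apply Finset.sum_eq_zero
  intro a _
  have h1 := LL_tail P hcube h a true
  have h2 := LL_nonneg P hcube ((a, true) :: h)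
  rw [le_antisymm (h0 ▸ h1) h2, mul_zero]

lemma agree_alg (alg1 alg2 : Alg A) (n₀ : ℕ)
    (hno : ∀ n < n₀, ¬ DeviatesAt P alg2 alg1 n) (h : History A) (hf : 0 < LL P h)
    (hl : h.length + 1 < n₀) (hc : cw alg2 h = cw alg1 h) (hne : cw alg1 h ≠ 0) :
    alg2 h = alg1 h := by
  by_contra hne'
  have hpos : 0 < cw alg1 h := lt_of_le_of_ne (cw_nonneg _ _) hne.symm
  refine hno _ hl ⟨{h}, by simp, ⟨h, rfl, ?_⟩, ⟨h, rfl, ?_⟩, by simpa using hne'⟩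
  · rw [prH_eq, hc]; positivity
  · rw [prH_eq]; positivity

lemma agree_cw (hcube : PriorOnUnitCube P) (alg1 alg2 : Alg A) (n₀ : ℕ)
    (hno : ∀ n < n₀, ¬ DeviatesAt P alg2 alg1 n) (h : History A) (hf : 0 < LL P h)
    (hl : h.length < n₀) : cw alg2 h = cw alg1 h := by
  induction h with
  | nil => simp [cw]
  | cons x h ih =>
    obtain ⟨a, r⟩ := x
    have hf' : 0 < LL P h := hf.trans_le (LL_tail P hcube h a r)
    simp only [List.length_cons] at hl
    have h1 := ih hf' (by omega)
    simp only [cw]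
    by_cases h0 : cw alg1 h = 0
    · rw [h1, h0]; simp
    · rw [h1, agree_alg P alg1 alg2 n₀ hno h hf' hl h1 h0]

lemma SS_eq (hcube : PriorOnUnitCube P) (alg1 alg2 : Alg A) (n₀ : ℕ)
    (hno : ∀ n < n₀, ¬ DeviatesAt P alg2 alg1 n) (i : ℕ) (hi : i + 1 < n₀) :
    SS P alg2 i = SS P alg1 i := by
  apply Finset.sum_congr rfl
  intro h hh
  rw [mem_hs] at hh
  rcases (LL_nonneg P hcube h).eq_or_lt with h0 | hpos
  · rw [GG_zero P hcube _ _ h0.symm, GG_zero P hcube _ _ h0.symm]; simp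
  · have h1 := agree_cw P hcube alg1 alg2 n₀ hno h hpos (by omega)
    by_cases h0 : cw alg1 h = 0
    · rw [h1, h0]; simp
    · rw [h1, GG, GG, agree_alg P alg1 alg2 n₀ hno h hpos (by omega) h1 h0]

lemma SS_lt (hcube : PriorOnUnitCube P) (hdist : DistinctPosteriorMeans P)
    (alg1 alg2 : Alg A) (hBG : IsBayesGreedy P alg1) (m : ℕ)
    (hdev : DeviatesFrom P alg2 alg1 (m + 1)) :
    SS P alg2 m < SS P alg1 m := by
  obtain ⟨⟨H, hlen, ⟨h, hH, hpos⟩, -, hne⟩, hno⟩ := hdev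
  rw [prH_eq] at hpos
  have hf : 0 < LL P h := (LL_nonneg P hcube h).lt_of_ne' (by rintro h0; simp [h0] at hpos)
  have hc2 : 0 < cw alg2 h := (cw_nonneg alg2 h).lt_of_ne' (by rintro h0; simp [h0] at hpos)
  have hl : h.length = m := by have := hlen h hH; omega
  apply Finset.sum_lt_sum
  · intro k hk
    rw [mem_hs] at hk
    rcases (LL_nonneg P hcube k).eq_or_lt with h0 | hposk
    · rw [GG_zero P hcube _ _ h0.symm, GG_zero P hcube _ _ h0.symm]; simp
    · rw [agree_cw P hcube alg1 alg2 _ hno k hposk (by omega)]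
      exact mul_le_mul_of_nonneg_left (GG_le P hcube _ _ hBG k) (cw_nonneg _ _)
  · refine ⟨h, (mem_hs _ _).2 hl, ?_⟩
    rw [← agree_cw P hcube alg1 alg2 _ hno h hf (by omega)]
    exact mul_lt_mul_of_pos_left (GG_lt P hcube hdist _ _ hBG h hf (hne h hH)) hc2

/-- Distribution of the pair of local step counts. -/
noncomputable def pp (q : ℕ → ℝ) : ℕ → ℕ → ℕ → ℝ
  | 0, i, j => if i = 0 ∧ j = 0 then 1 else 0
  | t + 1, i, j =>
    (match i with
     | 0 => 0
     | i' + 1 => q t * pp q t i' j) +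
    (match j with
     | 0 => 0
     | j' + 1 => (1 - q t) * pp q t i j')

lemma pp_supp (q : ℕ → ℝ) (t i j : ℕ) (h : i + j ≠ t) : pp q t i j = 0 := by
  induction t generalizing i j with
  | zero => simp only [pp]; rw [if_neg]; omega
  | succ t ih =>
    rcases i with _ | i <;> rcases j with _ | j <;> simp only [pp]
    · simp
    · rw [ih _ _ (by omega)]; simp
    · rw [ih _ _ (by omega)]; simp
    · rw [ih _ _ (by omega), ih _ _ (by omega)]; simp

lemma pp_nonneg (q : ℕ → ℝ) (hq : ∀ t, 0 ≤ q t ∧ q t ≤ 1) (t i j : ℕ) : 0 ≤ pp q t i j := by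
  induction t generalizing i j with
  | zero => simp only [pp]; split_ifs <;> simp
  | succ t ih =>
    have h1 := (hq t).1
    have h2 : 0 ≤ 1 - q t := by linarith [(hq t).2]
    rcases i with _ | i <;> rcases j with _ | j <;> simp only [pp]
    · simp
    · have := mul_nonneg h2 (ih 0 j); linarith
    · have := mul_nonneg h1 (ih i 0); linarith
    · exact add_nonneg (mul_nonneg h1 (ih _ _)) (mul_nonneg h2 (ih _ _))

/-- Expectation with respect to `pp`. -/
noncomputable def EE (q : ℕ → ℝ) (t : ℕ) (f : ℕ → ℕ → ℝ) : ℝ :=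
  ∑ x ∈ Finset.HasAntidiagonal.antidiagonal t, pp q t x.1 x.2 * f x.1 x.2

lemma EE_succ (q : ℕ → ℝ) (t : ℕ) (f : ℕ → ℕ → ℝ) :
    EE q (t+1) f = q t * EE q t (fun i j => f (i+1) j) + (1 - q t) * EE q t (fun i j => f i (j+1)) := by
  unfold EE
  have : ∀ x : ℕ × ℕ, pp q (t+1) x.1 x.2 * f x.1 x.2 =
      (match x.1 with
       | 0 => 0
       | i' + 1 => q t * pp q t i' x.2) * f x.1 x.2 +
      (match x.2 with
       | 0 => 0
       | j' + 1 => (1 - q t) * pp q t x.1 j') * f x.1 x.2 := by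
    intro x; rw [← add_mul]; rfl
  rw [Finset.sum_congr rfl (fun x _ => this x), Finset.sum_add_distrib,
    Finset.Nat.sum_antidiagonal_succ]
  conv_lhs => rw [Finset.Nat.sum_antidiagonal_succ']
  simp only [zero_mul, zero_add, Finset.mul_sum, mul_assoc]

lemma EE_swap (q : ℕ → ℝ) (t : ℕ) (hq : ∀ s < t, q s = 1/2) (f : ℕ → ℕ → ℝ) :
    EE q t f = EE q t (fun i j => f j i) := by
  induction t generalizing f with
  | zero => simp [EE]
  | succ t ih =>
    have ih' := ih (fun s hs => hq s (by omega))
    rw [EE_succ, EE_succ, hq t (by omega), ih' (fun i j => f (i+1) j), ih' (fun i j => f i (j+1))]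
    ring

lemma pp_zero_pos (q : ℕ → ℝ) (t : ℕ) (hq : ∀ s < t, q s = 1/2) : 0 < pp q t 0 t := by
  induction t with
  | zero => simp [pp]
  | succ t ih =>
    have := ih (fun s hs => hq s (by omega))
    simp only [pp, hq t (by omega)]
    linarith

lemma inner_eq (hcube : PriorOnUnitCube P) (alg1 alg2 : Alg A) (c : ℝ) (i j : ℕ) :
    ∑ h1 ∈ hs A i, ∑ h2 ∈ hs A j, ∫ w, c * hProb alg1 w h1 * hProb alg2 w h2 *
      ∑ a : A, ((alg1 h1) a).toReal * w a ∂P = c * SS P alg1 i := by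
  unfold SS
  rw [Finset.mul_sum]
  apply Finset.sum_congr rfl
  intro h1 _
  rw [← integral_finsetSum]
  · have : ∀ w : A → ℝ, ∑ h2 ∈ hs A j, c * hProb alg1 w h1 * hProb alg2 w h2 *
      ∑ a : A, ((alg1 h1) a).toReal * w a =
      c * cw alg1 h1 * ∑ a : A, ((alg1 h1) a).toReal * lik w ((a, true) :: h1) := by
      intro w
      rw [← Finset.sum_mul, ← Finset.mul_sum, sum_hProb, hProb_eq, Finset.mul_sum, Finset.mul_sum]
      apply Finset.sum_congr rfl
      intro a _
      simp [lik]; ring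
    simp_rw [this]
    rw [integral_const_mul, integral_finsetSum _ (fun a _ => (lik_int P hcube _).const_mul _)]
    simp_rw [integral_const_mul]
    rw [mul_assoc]; rfl
  · intro h2 _
    have hm : Measurable (fun w : A → ℝ => c * hProb alg1 w h1 * hProb alg2 w h2 *
        ∑ a : A, ((alg1 h1) a).toReal * w a) := by
      simp_rw [hProb_eq]
      have m1 := lik_meas h1
      have m2 := lik_meas h2
      fun_prop
    refine integrable_of P hcube _ hm (|c| * cw alg1 h1 * cw alg2 h2) fun w hw => ?_
    have l1 := lik_bdd h1 w hw
    have l2 := lik_bdd h2 w hw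
    have u : ∑ a : A, ((alg1 h1) a).toReal * w a ≤ 1 := pmf_avg_le _ _ _ fun a => (hw a).2
    have v : 0 ≤ ∑ a : A, ((alg1 h1) a).toReal * w a := pmf_avg_ge _ _ _ fun a _ => (hw a).1
    have c1 := cw_nonneg alg1 h1
    have c2 := cw_nonneg alg2 h2
    rw [hProb_eq, hProb_eq]
    have e : c * (cw alg1 h1 * lik w h1) * (cw alg2 h2 * lik w h2) *
        ∑ a : A, ((alg1 h1) a).toReal * w a = (c * cw alg1 h1 * cw alg2 h2) *
        (lik w h1 * lik w h2 * ∑ a : A, ((alg1 h1) a).toReal * w a) := by ring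
    have k : lik w h1 * lik w h2 * ∑ a : A, ((alg1 h1) a).toReal * w a ≤ 1 :=
      mul_le_one₀ (mul_le_one₀ l1.2 l2.1 l2.2) v u
    have k0 : 0 ≤ lik w h1 * lik w h2 * ∑ a : A, ((alg1 h1) a).toReal * w a :=
      mul_nonneg (mul_nonneg l1.1 l2.1) v
    rw [e, abs_mul, abs_mul, abs_mul, abs_of_nonneg c1, abs_of_nonneg c2, abs_of_nonneg k0]
    exact mul_le_of_le_one_right (by positivity) k

lemma tsum_hs (t : ℕ) (F : History A × History A → ℝ)
    (hF : ∀ s, s.1.length + s.2.length ≠ t → F s = 0) :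
    ∑' s, F s = ∑ x ∈ Finset.HasAntidiagonal.antidiagonal t, ∑ h1 ∈ hs A x.1, ∑ h2 ∈ hs A x.2, F (h1, h2) := by
  rw [tsum_eq_sum (s := (Finset.HasAntidiagonal.antidiagonal t).biUnion fun x => hs A x.1 ×ˢ hs A x.2),
    Finset.sum_biUnion]
  · simp_rw [Finset.sum_product]
  · rintro ⟨a, b⟩ _ ⟨c, d⟩ _ hne
    rw [Function.onFun, Finset.disjoint_left]
    rintro ⟨h1, h2⟩ ha hb
    simp only [Finset.mem_product, mem_hs] at ha hb
    apply hne
    ext1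
    · exact ha.1.symm.trans hb.1
    · exact ha.2.symm.trans hb.2
  · intro s hs'
    apply hF
    intro heq
    apply hs'
    simp only [Finset.mem_biUnion, Finset.mem_product, mem_hs, Finset.HasAntidiagonal.mem_antidiagonal]
    exact ⟨(s.1.length, s.2.length), heq, rfl, rfl⟩

/-- Choice probability after `t` rounds. -/
noncomputable def qq (alg1 alg2 : Alg A) (fresp : ℝ → ℝ) (t : ℕ) : ℝ :=
  fresp (nextStepReward P alg1 Prod.fst (gameDist P alg1 alg2 fresp t) -
                nextStepReward P alg2 Prod.snd (gameDist P alg1 alg2 fresp t))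

lemma gameDist_eq (alg1 alg2 : Alg A) (fresp : ℝ → ℝ) (t : ℕ) (w : A → ℝ)
    (s : History A × History A) :
    gameDist P alg1 alg2 fresp t w s =
      pp (qq P alg1 alg2 fresp) t s.1.length s.2.length * hProb alg1 w s.1 * hProb alg2 w s.2 := by
  induction t generalizing s with
  | zero =>
    obtain ⟨h1, h2⟩ := s
    simp only [gameDist, pp]
    rcases h1 with _ | ⟨x, h1⟩ <;> rcases h2 with _ | ⟨y, h2⟩ <;> simp [hProb]
  | succ t ih =>
    obtain ⟨h1, h2⟩ := s
    have : gameDist P alg1 alg2 fresp (t+1) = stepDist alg1 alg2 (qq P alg1 alg2 fresp t)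
      (gameDist P alg1 alg2 fresp t) := rfl
    rw [this]
    simp only [stepDist]
    rcases h1 with _ | ⟨⟨a, r⟩, h1⟩ <;> rcases h2 with _ | ⟨⟨b, r'⟩, h2⟩ <;>
      simp only [ih, pp, hProb, List.length_cons, List.length_nil] <;> ring

lemma next1 (hcube : PriorOnUnitCube P) (alg1 alg2 : Alg A) (fresp : ℝ → ℝ) (t : ℕ) :
    nextStepReward P alg1 Prod.fst (gameDist P alg1 alg2 fresp t) =
      EE (qq P alg1 alg2 fresp) t (fun i _ => SS P alg1 i) := by
  unfold nextStepReward
  simp_rw [gameDist_eq]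
  rw [tsum_hs t]
  · unfold EE
    apply Finset.sum_congr rfl
    rintro ⟨i, j⟩ _
    rw [← inner_eq P hcube alg1 alg2]
    apply Finset.sum_congr rfl
    intro h1 hh1
    apply Finset.sum_congr rfl
    intro h2 hh2
    rw [mem_hs] at hh1 hh2
    simp only [hh1, hh2]
  · intro s hs'
    simp [pp_supp _ _ _ _ hs']

lemma next2 (hcube : PriorOnUnitCube P) (alg1 alg2 : Alg A) (fresp : ℝ → ℝ) (t : ℕ) :
    nextStepReward P alg2 Prod.snd (gameDist P alg1 alg2 fresp t) =
      EE (qq P alg1 alg2 fresp) t (fun _ j => SS P alg2 j) := by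
  unfold nextStepReward
  simp_rw [gameDist_eq]
  rw [tsum_hs t]
  · unfold EE
    apply Finset.sum_congr rfl
    rintro ⟨i, j⟩ _
    rw [← inner_eq P hcube alg2 alg1 _ j i, Finset.sum_comm]
    apply Finset.sum_congr rfl
    intro h1 hh1
    apply Finset.sum_congr rfl
    intro h2 hh2
    rw [mem_hs] at hh1 hh2
    simp only [hh1, hh2]
    congr 1; ext w; ring
  · intro s hs'
    simp [pp_supp _ _ _ _ hs']

lemma game_core (q S1 S2 : ℕ → ℝ) (fresp : ℝ → ℝ) (hHM : IsHardMax fresp) (htie : fresp 0 = 1/2)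
    (hq : ∀ t, q t = fresp (EE q t (fun i _ => S1 i) - EE q t (fun _ j => S2 j)))
    (m : ℕ) (heq : ∀ i < m, S2 i = S1 i) (hlt : S2 m < S1 m) (hmono : ∀ i, S1 i ≤ S1 (i+1))
    (t : ℕ) (ht : m ≤ t) : q t = 1 := by
  have hq01 : ∀ t, 0 ≤ q t ∧ q t ≤ 1 := by
    intro t
    rw [hq t]
    generalize EE q t (fun i _ => S1 i) - EE q t (fun _ j => S2 j) = x
    rcases lt_trichotomy x 0 with h | h | h
    · rw [hHM.2 x h]; norm_num
    · rw [h, htie]; norm_num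
    · rw [hHM.1 x h]; norm_num
  have hhalf : ∀ t < m, q t = 1/2 := by
    intro t
    induction t using Nat.strong_induction_on with
    | _ t ih =>
      intro htm
      have e : EE q t (fun _ j => S2 j) = EE q t (fun _ j => S1 j) := by
        apply Finset.sum_congr rfl
        rintro ⟨i, j⟩ hij
        rw [Finset.HasAntidiagonal.mem_antidiagonal] at hij
        simp only at hij ⊢
        rw [heq j (by omega)]
      rw [hq t, EE_swap q t (fun s hs => ih s hs (by omega)), e, sub_self, htie]
  have hstrict : EE q m (fun _ j => S2 j) < EE q m (fun i _ => S1 i) := by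
    rw [EE_swap q m hhalf (fun i _ => S1 i)]
    apply Finset.sum_lt_sum
    · rintro ⟨i, j⟩ hij
      rw [Finset.HasAntidiagonal.mem_antidiagonal] at hij
      simp only at hij ⊢
      apply mul_le_mul_of_nonneg_left _ (pp_nonneg q hq01 _ _ _)
      rcases Nat.lt_or_ge j m with h | h
      · exact (heq j h).le
      · have : j = m := by omega
        rw [this]; exact hlt.le
    · exact ⟨(0, m), by simp, mul_lt_mul_of_pos_left hlt (pp_zero_pos q m hhalf)⟩
  have main : ∀ t, m ≤ t → EE q t (fun _ j => S2 j) < EE q t (fun i _ => S1 i) := by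
    intro t ht
    induction t, ht using Nat.le_induction with
    | base => exact hstrict
    | succ t ht ih =>
      have h1 : q t = 1 := by rw [hq t]; exact hHM.1 _ (by linarith)
      rw [EE_succ, EE_succ, h1]
      have : EE q t (fun i _ => S1 i) ≤ EE q t (fun i _ => S1 (i+1)) :=
        Finset.sum_le_sum fun x _ => mul_le_mul_of_nonneg_left (hmono _) (pp_nonneg q hq01 _ _ _)
      linarith
  rw [hq t]
  exact hHM.1 _ (by linarith [main t ht])

end helpers

/-- **Theorem (HardMax, fair tie-breaking: BayesGreedy wins everything).**
Assume the `HardMax` response function with fair tie-breaking `fresp 0 = 1/2`.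
If `alg1` is `BayesGreedy` and `alg2` deviates from `BayesGreedy` starting from some
local step `n₀ < T`, then every agent in global rounds `t ≥ n₀` selects principal 1
(with probability 1). -/
theorem hardMax_bayesGreedy_wins
    {A : Type} [Fintype A] [Nonempty A]
    (P : Measure (A → ℝ)) [IsProbabilityMeasure P]
    (hcube : PriorOnUnitCube P)
    (hbest : EachArmCanBeBest P)
    (hdistinct : DistinctPosteriorMeans P)
    (fresp : ℝ → ℝ) (hHM : IsHardMax fresp) (htie : fresp 0 = 1/2)
    (alg1 alg2 : Alg A) (hBG : IsBayesGreedy P alg1)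
    (T n₀ : ℕ) (hn₀T : n₀ < T)
    (hdev : DeviatesFrom P alg2 alg1 n₀) :
    ∀ t : ℕ, n₀ ≤ t → t ≤ T → probChoose1 P alg1 alg2 fresp t = 1 := by
  intro t ht _
  obtain ⟨h, hH, _⟩ := hdev.1.choose_spec.2.1
  have hl := hdev.1.choose_spec.1 h hH
  obtain ⟨m, rfl⟩ : ∃ m, n₀ = m + 1 := ⟨h.length, hl.symm⟩
  have := game_core (qq P alg1 alg2 fresp) (SS P alg1) (SS P alg2) fresp hHM htie
    (fun t => by rw [← next1 P hcube, ← next2 P hcube]; rfl) m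
    (fun i hi => SS_eq P hcube alg1 alg2 (m + 1) hdev.2 i (by omega))
    (SS_lt P hcube hdistinct alg1 alg2 hBG m hdev) (SS_mono P hcube alg1 hBG) (t - 1) (by omega)
  exact this

end BayesianChoice
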